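/- arXiv:2009.14069 — 4 statements merged into one kernel-verified Lean document; each statement's English description precedes it below -/
import Mathlib

section
/- Let s be a complex number with Re s > 1 and let m, n be positive integers. Then ∑_{(k,l) ∈ ℕ⁺ × ℕ⁺, k m = l n} 1/(k^s l^s) = ζ(2s) · gcd(m,n)^{2s} / (m n)^s. (In terms of power series, this computes the ℓ²-type pairing of the dilates of the polylogarithm: if L_s(z) = ∑_{k ≥ 1} z^k/k^s, then the coefficientwise inner product of L_s(z^m) and L_s(z^n) equals ζ(2s) gcd(m,n)^{2s}/(mn)^s when s is real.) -/
/- For Re s > 1 and positive integers m, n: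
∑_{km = ln} 1/(k^s l^s) = ζ(2s) gcd(m,n)^{2s} / (mn)^s,
the sum running over pairs of positive integers (k,l) with km = ln. -/
theorem stmt_9 (s : ℂ) (hs : 1 < s.re) (m n : ℕ) (hm : 0 < m) (hn : 0 < n) :
    ∑' p : {p : ℕ+ × ℕ+ // (p.1 : ℕ) * m = (p.2 : ℕ) * n},
        1 / (((p.1.1 : ℕ) : ℂ) ^ s * ((p.1.2 : ℕ) : ℂ) ^ s)
      = riemannZeta (2 * s) * ((Nat.gcd m n : ℕ) : ℂ) ^ (2 * s) / ((m * n : ℕ) : ℂ) ^ s := by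
  have hg : 0 < Nat.gcd m n := Nat.gcd_pos_of_pos_left n hm
  obtain ⟨a, b, hab, ha, hb⟩ := Nat.exists_coprime m n
  generalize Nat.gcd m n = g at *
  subst ha hb
  have ha0 : 0 < a := Nat.pos_of_mul_pos_right hm
  have hb0 : 0 < b := Nat.pos_of_mul_pos_right hn
  let f : ℕ → {p : ℕ+ × ℕ+ // (p.1 : ℕ) * (a * g) = (p.2 : ℕ) * (b * g)} := fun t =>
    ⟨(⟨b * (t + 1), by positivity⟩, ⟨a * (t + 1), by positivity⟩), by
      simp only [PNat.mk_coe]; ring⟩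
  have hf : Function.Bijective f := by
    constructor
    · intro t u h
      have h1 : b * (t + 1) = b * (u + 1) := congrArg (fun p : {p : ℕ+ × ℕ+ // (p.1 : ℕ) * (a * g) = (p.2 : ℕ) * (b * g)} => (p.1.1 : ℕ)) h
      have := Nat.eq_of_mul_eq_mul_left hb0 h1
      omega
    · rintro ⟨⟨k, l⟩, h⟩
      have h' : (k : ℕ) * a = l * b := by
        apply Nat.eq_of_mul_eq_mul_right hg
        simpa [mul_assoc] using h
      have hd : b ∣ (k : ℕ) := hab.symm.dvd_of_dvd_mul_right ⟨l, by rw [h', mul_comm]⟩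
      obtain ⟨t, ht⟩ := hd
      have hl : (l : ℕ) = a * t := by
        apply Nat.eq_of_mul_eq_mul_right hb0
        rw [← h', ht]; ring
      have ht0 : t ≠ 0 := by
        rintro rfl
        have := k.pos
        simp [ht] at this
      obtain ⟨u, rfl⟩ := Nat.exists_eq_succ_of_ne_zero ht0
      refine ⟨u, ?_⟩
      apply Subtype.ext
      apply Prod.ext
      · exact PNat.eq ht.symm
      · exact PNat.eq hl.symm
  rw [← (Equiv.ofBijective f hf).tsum_eq]
  have hz : riemannZeta (2 * s) = ∑' t : ℕ, 1 / ((t : ℂ) + 1) ^ (2 * s) :=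
    zeta_eq_tsum_one_div_nat_add_one_cpow (by simp; linarith)
  rw [hz, mul_div_assoc, ← tsum_mul_right]
  refine tsum_congr fun t => ?_
  have hne : ∀ x : ℕ, 0 < x → (x : ℂ) ^ s ≠ 0 := fun x hx => by
    rw [Complex.cpow_ne_zero_iff]; left; exact_mod_cast hx.ne'
  have hsq : ∀ x : ℕ, 0 < x → (x : ℂ) ^ (2 * s) = (x : ℂ) ^ s * (x : ℂ) ^ s := fun x hx => by
    rw [two_mul, Complex.cpow_add _ _ (by exact_mod_cast hx.ne')]
  have e1 : (Equiv.ofBijective f hf t).1.1 = (⟨b * (t + 1), by positivity⟩ : ℕ+) := rfl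
  have e2 : (Equiv.ofBijective f hf t).1.2 = (⟨a * (t + 1), by positivity⟩ : ℕ+) := rfl
  have ht : ((t : ℂ) + 1) = ((t + 1 : ℕ) : ℂ) := by push_cast; rfl
  rw [e1, e2, ht, hsq _ hg, hsq _ t.succ_pos]
  simp only [PNat.mk_coe]
  have hmul : ∀ x y : ℕ, ((x * y : ℕ) : ℂ) ^ s = (x : ℂ) ^ s * (y : ℂ) ^ s := fun x y => by
    rw [Nat.cast_mul, Complex.natCast_mul_natCast_cpow]
  simp only [hmul]
  have := hne a ha0
  have := hne b hb0
  have := hne g hg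
  have := hne (t + 1) t.succ_pos
  field_simp
end

section
/- Let s be a complex number with Re s > 1, let m, n be positive integers, set g = gcd(m, n) and δ = n/g = lcm(m,n)/m. Then ∑_{(k,l) ∈ ℕ⁺ × ℕ⁺, k m = l n} μ(k)/(k^s l^s) = (g^{2s}/(mn)^s) · μ(δ) · ∑_{j ≥ 1, gcd(j, δ) = 1} μ(j)/j^{2s}. (This computes the coefficientwise inner product of M_s(z^m) = ∑_k μ(k) z^{km}/k^s and L_s(z^n) = ∑_l z^{ln}/l^s for real s.) -/
/-- The solutions of k m = l n are (δ j, ε j). -/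
noncomputable def pairEquiv (m n g d e : ℕ) (hg : 0 < g) (hd : 0 < d) (he : 0 < e)
    (hm : m = g * e) (hn : n = g * d) (hc : Nat.Coprime d e) :
    ℕ+ ≃ {p : ℕ+ × ℕ+ // (p.1 : ℕ) * m = (p.2 : ℕ) * n} :=
  Equiv.ofBijective
    (fun j => ⟨((⟨d * j, Nat.mul_pos hd j.pos⟩ : ℕ+), (⟨e * j, Nat.mul_pos he j.pos⟩ : ℕ+)), by
      subst hm hn
      simp only [PNat.mk_coe]
      ring⟩) (by
    constructor
    · intro i j h
      have h := congrArg (fun p => (p.1.1 : ℕ)) h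
      exact PNat.eq (Nat.eq_of_mul_eq_mul_left hd h)
    · rintro ⟨⟨k, l⟩, h⟩
      simp only at h
      subst hm hn
      have h1 : (k : ℕ) * e = l * d := by
        apply Nat.eq_of_mul_eq_mul_left hg
        linarith
      have h2 : d ∣ (k : ℕ) := hc.dvd_of_dvd_mul_right ⟨l, by rw [h1]; ring⟩
      obtain ⟨j, hj⟩ := h2
      have hj0 : 0 < j := by
        rcases Nat.eq_zero_or_pos j with h0 | h0
        · have := k.pos
          simp [h0] at hj
        · exact h0
      have hl : (l : ℕ) = e * j := by
        apply Nat.eq_of_mul_eq_mul_left hd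
        rw [hj] at h1
        linarith
      refine ⟨⟨j, hj0⟩, ?_⟩
      apply Subtype.ext
      apply Prod.ext
      · apply PNat.eq
        simp [hj]
      · apply PNat.eq
        simp [hl])

theorem stmt_10 (s : ℂ) (hs : 1 < s.re) (m n : ℕ) (hm : 0 < m) (hn : 0 < n) :
    ∑' p : {p : ℕ+ × ℕ+ // (p.1 : ℕ) * m = (p.2 : ℕ) * n},
        (ArithmeticFunction.moebius ((p.1.1 : ℕ)) : ℂ) /
          (((p.1.1 : ℕ) : ℂ) ^ s * ((p.1.2 : ℕ) : ℂ) ^ s)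
      = (((Nat.gcd m n : ℕ) : ℂ) ^ (2 * s) / ((m * n : ℕ) : ℂ) ^ s) *
          (ArithmeticFunction.moebius (n / Nat.gcd m n) : ℂ) *
          ∑' j : {j : ℕ+ // Nat.Coprime (j : ℕ) (n / Nat.gcd m n)},
            (ArithmeticFunction.moebius ((j : ℕ+) : ℕ) : ℂ) / (((j : ℕ+) : ℕ) : ℂ) ^ (2 * s) := by
  have hg : 0 < Nat.gcd m n := Nat.gcd_pos_of_pos_left _ hm
  have hme : m = Nat.gcd m n * (m / Nat.gcd m n) := (Nat.mul_div_cancel' (Nat.gcd_dvd_left m n)).symm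
  have hnd : n = Nat.gcd m n * (n / Nat.gcd m n) := (Nat.mul_div_cancel' (Nat.gcd_dvd_right m n)).symm
  have hc : Nat.Coprime (n / Nat.gcd m n) (m / Nat.gcd m n) :=
    (Nat.coprime_div_gcd_div_gcd hg).symm
  generalize hgg : Nat.gcd m n = g at *
  generalize m / g = e at *
  generalize n / g = d at *
  have he : 0 < e := Nat.pos_of_ne_zero (by rintro rfl; simp at hme; omega)
  have hd : 0 < d := Nat.pos_of_ne_zero (by rintro rfl; simp at hnd; omega)
  have hE1 : ∀ j, (((pairEquiv m n g d e hg hd he hme hnd hc) j).1.1 : ℕ) = d * j := fun _ => rfl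
  have hE2 : ∀ j, (((pairEquiv m n g d e hg hd he hme hnd hc) j).1.2 : ℕ) = e * j := fun _ => rfl
  rw [← (pairEquiv m n g d e hg hd he hme hnd hc).tsum_eq]
  rw [← tsum_mul_left]
  have hsub := tsum_subtype {j : ℕ+ | Nat.Coprime (j : ℕ) d} (fun j : ℕ+ =>
    ((g : ℂ) ^ (2 * s) / ((m * n : ℕ) : ℂ) ^ s) * (ArithmeticFunction.moebius d : ℂ) *
      ((ArithmeticFunction.moebius (j : ℕ) : ℂ) / ((j : ℕ) : ℂ) ^ (2 * s)))
  refine Eq.trans ?_ hsub.symm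
  apply tsum_congr
  intro j
  simp only [hE1, hE2, Set.indicator,
    Set.mem_ofPred_eq]
  split_ifs with h
  · rw [ArithmeticFunction.isMultiplicative_moebius.map_mul_of_coprime h.symm, hme, hnd]
    have hj : ((j : ℕ) : ℂ) ≠ 0 := by exact_mod_cast j.pos.ne'
    have hg' : (g : ℂ) ≠ 0 := by exact_mod_cast hg.ne'
    have hd' : (d : ℂ) ≠ 0 := by exact_mod_cast hd.ne'
    have he' : (e : ℂ) ≠ 0 := by exact_mod_cast he.ne'
    have two : ∀ x : ℂ, x ≠ 0 → x ^ (2 * s) = x ^ s * x ^ s := fun x hx => by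
      rw [two_mul, Complex.cpow_add _ _ hx]
    rw [two _ hj, two _ hg']
    have nm : ∀ a b : ℕ, ((a * b : ℕ) : ℂ) ^ s = (a : ℂ) ^ s * (b : ℂ) ^ s := fun a b => by
      rw [Nat.cast_mul, Complex.natCast_mul_natCast_cpow]
    simp only [nm]
    have c0 : ∀ x : ℂ, x ≠ 0 → x ^ s ≠ 0 := fun x hx => by simp [Complex.cpow_eq_zero_iff, hx]
    have := c0 _ hj
    have := c0 _ hg'
    have := c0 _ hd'
    have := c0 _ he'
    push_cast
    field_simp
  · rw [ArithmeticFunction.moebius_eq_zero_of_not_squarefree]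
    · simp
    · intro hsq
      exact h (Nat.coprime_of_squarefree_mul hsq).symm
end

section
/- Let f(z) = ∑_{k ≥ 2} a_k z^k be a power series with complex coefficients and radius of convergence at least R > 0 (note the sum starts at k = 2). Then for every complex z with |z| < R and every complex s with Re s > 1/2, the double family (a_k (z/n^s)^k)_{n ≥ 1, k ≥ 2} is absolutely summable and ∑_{n=1}^∞ f(z/n^s) = ∑_{k=2}^∞ a_k ζ(ks) z^k. In particular, taking f(z) = cos z − 1 and s = 1, one obtains, for every z ∈ ℂ, ∑_{j=1}^∞ ( cos(z/j) − 1 ) = ∑_{k=1}^∞ (−1)^k ζ(2k) z^{2k} / (2k)!. -/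
theorem aux_main (a : ℕ → ℂ) (ha0 : a 0 = 0) (ha1 : a 1 = 0) (R : ℝ)
    (hrad : ∀ z : ℂ, ‖z‖ < R → Summable fun k : ℕ => ‖a k * z ^ k‖)
    (z : ℂ) (hz : ‖z‖ < R) (s : ℂ) (hs : 1 / 2 < s.re) :
      (Summable fun p : ℕ+ × ℕ => ‖a p.2 * (z / ((p.1 : ℕ) : ℂ) ^ s) ^ p.2‖) ∧
      ∑' n : ℕ+, (∑' k : ℕ, a k * (z / ((n : ℕ) : ℂ) ^ s) ^ k)
        = ∑' k : ℕ, a k * riemannZeta ((k : ℂ) * s) * z ^ k := by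
  have hsum : Summable fun p : ℕ+ × ℕ => ‖a p.2 * (z / ((p.1 : ℕ) : ℂ) ^ s) ^ p.2‖ := by
    have h1 : Summable fun n : ℕ+ => 1 / ((n : ℕ) : ℝ) ^ (2 * s.re) :=
      (Real.summable_one_div_nat_rpow.mpr (by linarith)).comp_injective PNat.coe_injective
    have h2 := h1.mul_of_nonneg (hrad z hz) (fun n => by positivity) (fun k => norm_nonneg _)
    refine Summable.of_nonneg_of_le (fun _ => norm_nonneg _) ?_ h2
    rintro ⟨n, k⟩
    rcases k with _ | _ | k
    · simp [ha0]
    · simp [ha1]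
    · have hn : (1 : ℝ) ≤ ((n : ℕ) : ℝ) := by exact_mod_cast n.pos
      have hn0 : (0 : ℝ) < ((n : ℕ) : ℝ) := by linarith
      have hnorm : ‖((n : ℕ) : ℂ) ^ s‖ = ((n : ℕ) : ℝ) ^ s.re :=
        Complex.norm_natCast_cpow_of_pos n.pos s
      have hge : ((n : ℕ) : ℝ) ^ (2 * s.re) ≤ (((n : ℕ) : ℝ) ^ s.re) ^ (k + 1 + 1) := by
        rw [mul_comm, Real.rpow_mul hn0.le]
        rw [show (2 : ℝ) = ((2 : ℕ) : ℝ) by norm_num, Real.rpow_natCast]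
        exact pow_le_pow_right₀ (Real.one_le_rpow hn (by linarith)) (by omega)
      have hp : 0 < ((n : ℕ) : ℝ) ^ (2 * s.re) := Real.rpow_pos_of_pos hn0 _
      simp only [norm_mul, norm_pow, norm_div, hnorm, div_pow]
      calc ‖a (k + 1 + 1)‖ * (‖z‖ ^ (k + 1 + 1) / (((n : ℕ) : ℝ) ^ s.re) ^ (k + 1 + 1))
          ≤ ‖a (k + 1 + 1)‖ * (‖z‖ ^ (k + 1 + 1) / ((n : ℕ) : ℝ) ^ (2 * s.re)) := by
            gcongr
        _ = _ := by ring
  refine ⟨hsum, ?_⟩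
  rw [← Summable.tsum_comm (f := fun (n : ℕ+) (k : ℕ) => a k * (z / ((n : ℕ) : ℂ) ^ s) ^ k)
    hsum.of_norm]
  refine tsum_congr fun k => ?_
  by_cases hk : k < 2
  · have : a k = 0 := by interval_cases k <;> assumption
    simp [this]
  · have hk2 : (2 : ℝ) ≤ k := by exact_mod_cast not_lt.mp hk
    have hre : 1 < ((k : ℂ) * s).re := by
      simp only [Complex.mul_re, Complex.natCast_re, Complex.natCast_im, zero_mul, sub_zero]
      nlinarith
    rw [zeta_eq_tsum_one_div_nat_add_one_cpow hre]
    have h3 := tsum_pnat_eq_tsum_succ (f := fun n : ℕ => 1 / (n : ℂ) ^ ((k : ℂ) * s))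
    push_cast at h3
    rw [← h3, mul_right_comm, ← tsum_mul_left]
    refine tsum_congr fun n => ?_
    rw [Complex.cpow_nat_mul, div_pow]
    ring

noncomputable def auxCoeff (k : ℕ) : ℂ :=
  if Even k ∧ k ≠ 0 then (-1 : ℂ) ^ (k / 2) / (k.factorial : ℂ) else 0

theorem auxCoeff_even (k : ℕ+) :
    auxCoeff (2 * (k : ℕ)) = (-1 : ℂ) ^ (k : ℕ) / ((2 * (k : ℕ)).factorial : ℂ) := by
  have := k.pos
  rw [auxCoeff, if_pos ⟨even_two_mul _, by omega⟩]
  simp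

theorem auxCoeff_tsum (g : ℕ → ℂ) :
    ∑' k : ℕ, auxCoeff k * g k = ∑' k : ℕ+, auxCoeff (2 * (k : ℕ)) * g (2 * (k : ℕ)) := by
  have hinj : Function.Injective (fun k : ℕ+ => 2 * (k : ℕ)) := by
    intro x y h
    apply PNat.coe_injective
    simpa using h
  refine (hinj.tsum_eq (f := fun k => auxCoeff k * g k) ?_).symm
  intro k hk
  have h1 : auxCoeff k ≠ 0 := left_ne_zero_of_mul hk
  rw [auxCoeff] at h1
  have h2 : Even k ∧ k ≠ 0 := by
    by_contra h
    exact h1 (if_neg h)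
  obtain ⟨⟨m, hm⟩, h0⟩ := h2
  exact ⟨⟨m, by omega⟩, by simp; omega⟩

theorem auxCoeff_summable (z : ℂ) : Summable fun k : ℕ => ‖auxCoeff k * z ^ k‖ := by
  refine Summable.of_nonneg_of_le (fun _ => norm_nonneg _) ?_ (Real.summable_pow_div_factorial ‖z‖)
  intro k
  rw [auxCoeff]
  split_ifs
  · simp [div_eq_mul_inv, mul_comm]
  · simp; positivity

theorem auxCoeff_cos (w : ℂ) : ∑' k : ℕ, auxCoeff k * w ^ k = Complex.cos w - 1 := by
  rw [auxCoeff_tsum]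
  simp only [auxCoeff_even]
  have h := Complex.hasSum_cos w
  have h1 := h.summable.tsum_eq_zero_add
  rw [h.tsum_eq] at h1
  rw [tsum_pnat_eq_tsum_succ
    (f := fun k : ℕ => (-1 : ℂ) ^ k / ((2 * k).factorial : ℂ) * w ^ (2 * k)), h1]
  simp only [pow_zero, mul_zero, Nat.factorial_zero, Nat.cast_one, mul_one, div_one,
    add_sub_cancel_left]
  exact tsum_congr fun k => by ring

/- Let f(z) = ∑_{k≥2} a_k z^k have radius of convergence at least R > 0
(expressed by absolute summability of the coefficients against every |z| < R,
with a_0 = a_1 = 0).  Then for |z| < R and Re s > 1/2 the double family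
(a_k (z/n^s)^k)_{n≥1,k≥2} is absolutely summable and
∑_{n≥1} f(z/n^s) = ∑_{k≥2} a_k ζ(ks) z^k.  In particular, for f = cos − 1 and
s = 1: ∑_{j≥1} (cos(z/j) − 1) = ∑_{k≥1} (−1)^k ζ(2k) z^{2k}/(2k)! for all z. -/
theorem stmt_17 (a : ℕ → ℂ) (ha0 : a 0 = 0) (ha1 : a 1 = 0) (R : ℝ) (hR : 0 < R)
    (hrad : ∀ z : ℂ, ‖z‖ < R → Summable fun k : ℕ => ‖a k * z ^ k‖) :
    (∀ z : ℂ, ‖z‖ < R → ∀ s : ℂ, 1 / 2 < s.re →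
      (Summable fun p : ℕ+ × ℕ => ‖a p.2 * (z / ((p.1 : ℕ) : ℂ) ^ s) ^ p.2‖) ∧
      ∑' n : ℕ+, (∑' k : ℕ, a k * (z / ((n : ℕ) : ℂ) ^ s) ^ k)
        = ∑' k : ℕ, a k * riemannZeta ((k : ℂ) * s) * z ^ k) ∧
    ∀ z : ℂ,
      ∑' j : ℕ+, (Complex.cos (z / ((j : ℕ) : ℂ)) - 1)
        = ∑' k : ℕ+, (-1 : ℂ) ^ ((k : ℕ)) * riemannZeta (2 * (k : ℕ)) * z ^ (2 * (k : ℕ)) /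
            ((2 * (k : ℕ)).factorial : ℂ) := by
  refine ⟨fun z hz s hs => aux_main a ha0 ha1 R hrad z hz s hs, fun z => ?_⟩
  have h := (aux_main auxCoeff (by simp [auxCoeff]) (by simp [auxCoeff]) (‖z‖ + 1)
    (fun w _ => auxCoeff_summable w) z (by linarith) 1 (by norm_num)).2
  simp only [Complex.cpow_one, auxCoeff_cos, mul_one, mul_assoc] at h
  rw [h, auxCoeff_tsum (fun k => riemannZeta k * z ^ k)]
  refine tsum_congr fun k => ?_
  rw [auxCoeff_even]
  push_cast
  ring
end

section
/- Let U ⊆ ℂ be an open set containing 0 which is star-shaped with respect to 0, and let f be holomorphic on U with f(0) = 0. For a complex number s with Re s > 0, define T_s(f)(z) = (1/Γ(s)) ∫_0^∞ f(e^{−t} z) t^{s−1} dt for z ∈ U (the integral converges absolutely since f(e^{−t}z) = O(e^{−t}) as t → ∞). Then the family (T_s)_{Re s > 0} is a semigroup: for all s₁, s₂ with Re s₁ > 0 and Re s₂ > 0 and all z ∈ U, T_{s₂}(T_{s₁}(f))(z) = T_{s₁ + s₂}(f)(z). -/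
open MeasureTheory

/-- The operator T_s f(z) = (1/Γ(s)) ∫_0^∞ f(e^{−t} z) t^{s−1} dt. -/
noncomputable def mellinOp (s : ℂ) (f : ℂ → ℂ) (z : ℂ) : ℂ :=
  (1 / Complex.Gamma s) *
    ∫ t in Set.Ioi (0 : ℝ), f (Complex.exp (-(t : ℂ)) * z) * ((t : ℂ) ^ (s - 1))

/-- The Gamma density, extended by zero. -/
noncomputable def gDens (s : ℂ) : ℝ → ℂ :=
  Set.indicator (Set.Ioi (0 : ℝ)) (fun x => ((Real.exp (-x) : ℝ) : ℂ) * (x : ℂ) ^ (s - 1))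

lemma gDens_integrable {s : ℂ} (hs : 0 < s.re) : Integrable (gDens s) :=
  (integrable_indicator_iff measurableSet_Ioi).2 (Complex.GammaIntegral_convergent hs)

lemma gDens_pos (s : ℂ) {x : ℝ} (hx : 0 < x) :
    gDens s x = Complex.exp (-(x : ℂ)) * (x : ℂ) ^ (s - 1) := by
  simp [gDens, hx]

lemma gDens_nonpos (s : ℂ) {x : ℝ} (hx : x ≤ 0) : gDens s x = 0 := by
  simp [gDens, hx]

lemma gDens_conv (s₁ s₂ : ℂ) {x : ℝ} (hx : 0 < x) :
    ∫ v : ℝ, gDens s₂ v * gDens s₁ (x - v) =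
      Complex.exp (-(x : ℂ)) * ((x : ℂ) ^ (s₂ + s₁ - 1) * Complex.betaIntegral s₂ s₁) := by
  rw [← Complex.betaIntegral_scaled s₂ s₁ hx, intervalIntegral.integral_of_le hx.le,
    integral_Ioc_eq_integral_Ioo, ← integral_const_mul, ← integral_indicator measurableSet_Ioo]
  congr 1
  ext v
  by_cases hv : v ∈ Set.Ioo 0 x
  · rw [Set.indicator_of_mem hv, gDens_pos _ hv.1, gDens_pos _ (sub_pos.2 hv.2)]
    have : Complex.exp (-(x : ℂ)) = Complex.exp (-(v : ℂ)) * Complex.exp (-((x - v : ℝ) : ℂ)) := by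
      rw [← Complex.exp_add]; congr 1; push_cast; ring
    rw [this]
    push_cast
    ring
  · rw [Set.indicator_of_notMem hv]
    by_cases h : 0 < v
    · have : x - v ≤ 0 := by
        by_contra hc
        exact hv ⟨h, by linarith⟩
      rw [gDens_nonpos _ this, mul_zero]
    · rw [gDens_nonpos _ (not_lt.1 h), zero_mul]

lemma exists_factor (U : Set ℂ) (hU : IsOpen U) (h0 : (0 : ℂ) ∈ U)
    (hstar : ∀ z ∈ U, ∀ r : ℝ, 0 ≤ r → r ≤ 1 → (r : ℂ) * z ∈ U)
    (f : ℂ → ℂ) (hf : DifferentiableOn ℂ f U) (hf0 : f 0 = 0) (z : ℂ) (hz : z ∈ U) :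
    ∃ (h : ℝ → ℂ) (C : ℝ), Continuous h ∧ (∀ x, ‖h x‖ ≤ C) ∧
      ∀ t : ℝ, 0 < t → f (Complex.exp (-(t : ℂ)) * z) = h t * Complex.exp (-(t : ℂ)) := by
  have hd : ContinuousOn (dslope f 0) U :=
    (continuousOn_dslope (hU.mem_nhds h0)).2
      ⟨hf.continuousOn, hf.differentiableAt (hU.mem_nhds h0)⟩
  have hk : ContinuousOn (fun r : ℝ => z * dslope f 0 ((r : ℂ) * z)) (Set.Icc 0 1) := by
    refine continuousOn_const.mul (hd.comp (by fun_prop) ?_)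
    intro r hr
    exact hstar z hz r hr.1 hr.2
  obtain ⟨C, hC⟩ := isCompact_Icc.exists_bound_of_continuousOn hk
  have hm : ∀ x : ℝ, Real.exp (-(max x 0)) ∈ Set.Icc (0 : ℝ) 1 := fun x =>
    ⟨(Real.exp_pos _).le, Real.exp_le_one_iff.2 (by simp)⟩
  refine ⟨fun x => z * dslope f 0 ((Real.exp (-(max x 0)) : ℝ) * z), C, ?_, fun x => hC _ (hm x), ?_⟩
  · exact hk.comp_continuous (f := fun x : ℝ => Real.exp (-(max x 0))) (by fun_prop) hm
  · intro t ht
    have := sub_smul_dslope f 0 (Complex.exp (-(t : ℂ)) * z)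
    simp only [max_eq_left ht.le]
    push_cast
    rw [hf0, sub_zero, sub_zero, smul_eq_mul] at this
    rw [← this]
    ring

/- Let U ⊆ ℂ be open, star-shaped with respect to 0 (and containing 0), and f
holomorphic on U with f(0) = 0.  Then for Re s₁ > 0, Re s₂ > 0 and z ∈ U,
T_{s₂}(T_{s₁}(f))(z) = T_{s₁+s₂}(f)(z): the operators form a semigroup. -/
theorem stmt_18 (U : Set ℂ) (hU : IsOpen U) (h0 : (0 : ℂ) ∈ U)
    (hstar : ∀ z ∈ U, ∀ r : ℝ, 0 ≤ r → r ≤ 1 → (r : ℂ) * z ∈ U)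
    (f : ℂ → ℂ) (hf : DifferentiableOn ℂ f U) (hf0 : f 0 = 0)
    (s₁ s₂ : ℂ) (h₁ : 0 < s₁.re) (h₂ : 0 < s₂.re) (z : ℂ) (hz : z ∈ U) :
    mellinOp s₂ (mellinOp s₁ f) z = mellinOp (s₁ + s₂) f z := by
  obtain ⟨h, C, hc, hb, hfac⟩ := exists_factor U hU h0 hstar f hf hf0 z hz
  have hint : Integrable (Function.uncurry
      (fun x v : ℝ => h x * (gDens s₂ v * gDens s₁ (x - v)))) (volume.prod volume) := by
    have := (gDens_integrable h₂).convolution_integrand (ContinuousLinearMap.mul ℝ ℂ)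
      (gDens_integrable h₁)
    exact this.bdd_mul (f := fun p : ℝ × ℝ => h p.1) (c := C)
      (hc.comp continuous_fst).aestronglyMeasurable (Filter.Eventually.of_forall fun p => hb p.1)
  have hswap := integral_integral_swap hint
  have hL : ∀ x : ℝ, ∫ v : ℝ, h x * (gDens s₂ v * gDens s₁ (x - v)) =
      Set.indicator (Set.Ioi (0 : ℝ)) (fun x : ℝ =>
        (f (Complex.exp (-(x : ℂ)) * z) * (x : ℂ) ^ (s₁ + s₂ - 1)) *
          Complex.betaIntegral s₂ s₁) x := by
    intro x
    rw [integral_const_mul]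
    by_cases hx : 0 < x
    · rw [Set.indicator_of_mem (show x ∈ Set.Ioi (0 : ℝ) from hx), gDens_conv _ _ hx, hfac x hx,
        add_comm s₂ s₁]
      ring
    · rw [Set.indicator_of_notMem (show x ∉ Set.Ioi (0 : ℝ) from hx)]
      have : ∀ v : ℝ, gDens s₂ v * gDens s₁ (x - v) = 0 := by
        intro v
        by_cases hv : 0 < v
        · rw [gDens_nonpos s₁ (by linarith), mul_zero]
        · rw [gDens_nonpos s₂ (not_lt.1 hv), zero_mul]
      simp [this]
  have hR : ∀ v : ℝ, ∫ x : ℝ, h x * (gDens s₂ v * gDens s₁ (x - v)) =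
      Set.indicator (Set.Ioi (0 : ℝ)) (fun v : ℝ =>
        Complex.Gamma s₁ * (mellinOp s₁ f (Complex.exp (-(v : ℂ)) * z) * (v : ℂ) ^ (s₂ - 1))) v := by
    intro v
    by_cases hv : 0 < v
    · rw [Set.indicator_of_mem (show v ∈ Set.Ioi (0 : ℝ) from hv)]
      have e := integral_add_right_eq_self (μ := volume)
        (fun x : ℝ => h x * (gDens s₂ v * gDens s₁ (x - v))) v
      rw [← e]
      unfold mellinOp
      rw [← mul_assoc, ← mul_assoc, mul_one_div_cancel (Complex.Gamma_ne_zero_of_re_pos h₁),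
        one_mul, ← integral_mul_const, ← integral_indicator measurableSet_Ioi]
      congr 1
      ext u
      rw [add_sub_cancel_right]
      by_cases hu : 0 < u
      · rw [Set.indicator_of_mem (show u ∈ Set.Ioi (0 : ℝ) from hu), gDens_pos _ hu,
          gDens_pos _ hv]
        have e1 : Complex.exp (-(u : ℂ)) * (Complex.exp (-(v : ℂ)) * z) =
            Complex.exp (-((u + v : ℝ) : ℂ)) * z := by
          rw [← mul_assoc, ← Complex.exp_add]; congr 2; push_cast; ring
        have e2 : Complex.exp (-((u + v : ℝ) : ℂ)) =
            Complex.exp (-(u : ℂ)) * Complex.exp (-(v : ℂ)) := by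
          rw [← Complex.exp_add]; congr 1; push_cast; ring
        rw [e1, hfac _ (add_pos hu hv), e2]
        ring
      · rw [Set.indicator_of_notMem (show u ∉ Set.Ioi (0 : ℝ) from hu),
          gDens_nonpos _ (not_lt.1 hu)]
        simp
    · rw [Set.indicator_of_notMem (show v ∉ Set.Ioi (0 : ℝ) from hv),
        gDens_nonpos _ (not_lt.1 hv)]
      simp
  simp_rw [hL, hR] at hswap
  rw [integral_indicator measurableSet_Ioi, integral_indicator measurableSet_Ioi,
    integral_mul_const, integral_const_mul,
    Complex.betaIntegral_eq_Gamma_mul_div _ _ h₂ h₁] at hswap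
  have g1 := Complex.Gamma_ne_zero_of_re_pos h₁
  have g2 := Complex.Gamma_ne_zero_of_re_pos h₂
  have g3 : Complex.Gamma (s₁ + s₂) ≠ 0 :=
    Complex.Gamma_ne_zero_of_re_pos (by rw [Complex.add_re]; exact add_pos h₁ h₂)
  rw [add_comm s₂ s₁] at hswap
  rw [mellinOp.eq_1 s₂, mellinOp.eq_1 (s₁ + s₂)]
  generalize (∫ t in Set.Ioi (0 : ℝ),
    mellinOp s₁ f (Complex.exp (-(t : ℂ)) * z) * ((t : ℂ) ^ (s₂ - 1))) = A at hswap ⊢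
  generalize (∫ t in Set.Ioi (0 : ℝ),
    f (Complex.exp (-(t : ℂ)) * z) * ((t : ℂ) ^ (s₁ + s₂ - 1))) = B at hswap ⊢
  have hA : A = B * (Complex.Gamma s₂ / Complex.Gamma (s₁ + s₂)) := by
    apply mul_left_cancel₀ g1
    rw [← hswap]
    ring
  rw [hA]
  field_simp
end
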